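/- For every y ∈ ℝ there exists θ > y such that (1/(1 − F(y))) · (−y/2 + F'(y)/(1 − F(y))) = 1/(4F'(θ)), and for every x ∈ ℝ there exists θ' < x such that (1/F(x)) · (x/2 + F'(x)/F(x)) = 1/(4F'(θ')). (These are the x = +∞ and y = −∞ limiting cases of the Cauchy mean value identities for F.) -/

import Mathlib

open Real Filter Finset

/-- The rescaled Gaussian cumulative distribution function
`F(ξ) = (1/(2√π)) ∫_{-∞}^{ξ} e^{-s²/4} ds`. -/
noncomputable def F (x : ℝ) : ℝ :=
  (1 / (2 * Real.sqrt Real.pi)) * ∫ s in Set.Iio x, Real.exp (-s ^ 2 / 4)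

/-- The derivative `F'(ξ) = (1/(2√π)) e^{-ξ²/4}`. -/
noncomputable def F' (x : ℝ) : ℝ :=
  (1 / (2 * Real.sqrt Real.pi)) * Real.exp (-x ^ 2 / 4)

open MeasureTheory Topology

lemma integrable_exp_neg_sq_div_four : Integrable fun s : ℝ => Real.exp (-s ^ 2 / 4) := by
  convert integrable_exp_neg_mul_sq (b := 1 / 4) (by norm_num) using 3
  ring

lemma F_eq_integral_Iic (x : ℝ) :
    F x = (1 / (2 * Real.sqrt Real.pi)) * ∫ s in Set.Iic x, Real.exp (-s ^ 2 / 4) := by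
  rw [F, integral_Iic_eq_integral_Iio]

lemma F_pos (x : ℝ) : 0 < F x := by
  refine mul_pos (by positivity) ?_
  rw [setIntegral_pos_iff_support_of_nonneg_ae (ae_of_all _ fun s => (Real.exp_pos _).le)
    integrable_exp_neg_sq_div_four.integrableOn]
  have : Function.support (fun s : ℝ => Real.exp (-s ^ 2 / 4)) = Set.univ :=
    Set.eq_univ_of_forall fun s => (Real.exp_pos _).ne'
  simp [this]

lemma F'_pos (x : ℝ) : 0 < F' x := by
  unfold F'
  positivity

lemma F'_neg (x : ℝ) : F' (-x) = F' x := by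
  simp [F']

lemma F_neg (x : ℝ) : F (-x) = 1 - F x := by
  have hsum := integral_add_compl (measurableSet_Iic (a := x)) integrable_exp_neg_sq_div_four
  have htotal : ∫ s : ℝ, Real.exp (-s ^ 2 / 4) = 2 * Real.sqrt Real.pi := by
    have h := integral_gaussian (1 / 4)
    have h4 : Real.pi / (1 / 4) = 2 ^ 2 * Real.pi := by ring
    rw [h4, Real.sqrt_mul (by norm_num), Real.sqrt_sq (by norm_num)] at h
    rw [← h]
    congr 1 with s
    ring_nf
  have hrefl := integral_comp_neg_Iic (-x) fun s : ℝ => Real.exp (-s ^ 2 / 4)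
  simp only [neg_sq, neg_neg] at hrefl
  rw [Set.compl_Iic, htotal, ← hrefl] at hsum
  have hpi : 0 < Real.sqrt Real.pi := Real.sqrt_pos.2 Real.pi_pos
  rw [F_eq_integral_Iic, F_eq_integral_Iic, eq_sub_iff_add_eq, ← mul_add, add_comm, hsum]
  field_simp

lemma hasDerivAt_F (x : ℝ) : HasDerivAt F (F' x) x := by
  have hc : Continuous fun s : ℝ => Real.exp (-s ^ 2 / 4) := by fun_prop
  have h := ((hc.integral_hasStrictDerivAt 0 x).hasDerivAt.const_add
    (∫ s in Set.Iic (0 : ℝ), Real.exp (-s ^ 2 / 4))).const_mul (1 / (2 * Real.sqrt Real.pi))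
  refine h.congr_of_eventuallyEq (Eventually.of_forall fun t => ?_)
  have hsub := intervalIntegral.integral_Iic_sub_Iic (a := 0) (b := t)
    integrable_exp_neg_sq_div_four.integrableOn integrable_exp_neg_sq_div_four.integrableOn
  simp only [F_eq_integral_Iic, ← hsub, add_sub_cancel]

lemma hasDerivAt_F' (x : ℝ) : HasDerivAt F' (-x / 2 * F' x) x := by
  have h := ((((hasDerivAt_id x).pow 2).neg.div_const 4).exp).const_mul
    (1 / (2 * Real.sqrt Real.pi))
  refine h.congr_deriv ?_
  simp [F']
  ring

lemma exp_neg_sq_div_four_le (s : ℝ) : Real.exp (-s ^ 2 / 4) ≤ Real.exp 1 * Real.exp s := by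
  rw [← Real.exp_add]
  exact Real.exp_le_exp.2 (by nlinarith [sq_nonneg (s / 2 + 1)])

lemma F_le_exp (x : ℝ) : F x ≤ 1 / (2 * Real.sqrt Real.pi) * (Real.exp 1 * Real.exp x) := by
  rw [F_eq_integral_Iic]
  gcongr
  rw [← integral_exp_Iic x, ← integral_const_mul]
  exact setIntegral_mono integrable_exp_neg_sq_div_four.integrableOn
    ((integrableOn_exp_Iic x).const_mul _) exp_neg_sq_div_four_le

lemma F'_le_exp (x : ℝ) : F' x ≤ 1 / (2 * Real.sqrt Real.pi) * (Real.exp 1 * Real.exp x) := by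
  unfold F'
  gcongr
  exact exp_neg_sq_div_four_le x

lemma tendsto_const_mul_exp_atBot (c d : ℝ) :
    Tendsto (fun x => c * (d * Real.exp x)) atBot (𝓝 0) := by
  simpa using (Real.tendsto_exp_atBot.const_mul d).const_mul c

lemma tendsto_F_atBot : Tendsto F atBot (𝓝 0) :=
  squeeze_zero (fun x => (F_pos x).le) F_le_exp (tendsto_const_mul_exp_atBot _ _)

lemma tendsto_F'_atBot : Tendsto F' atBot (𝓝 0) :=
  squeeze_zero (fun x => (F'_pos x).le) F'_le_exp (tendsto_const_mul_exp_atBot _ _)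

lemma tendsto_mul_F_atBot : Tendsto (fun x => x * F x) atBot (𝓝 0) := by
  have h : Tendsto (fun x : ℝ => |x| * Real.exp x) atBot (𝓝 0) := by
    have h := (Real.tendsto_pow_mul_exp_neg_atTop_nhds_zero 1).comp tendsto_neg_atBot_atTop
    simpa [Function.comp_def, abs_mul] using h.abs
  have h' := h.const_mul (1 / (2 * Real.sqrt Real.pi) * Real.exp 1)
  rw [mul_zero] at h'
  refine squeeze_zero_norm (fun x => ?_) h'
  rw [Real.norm_eq_abs, abs_mul, abs_of_pos (F_pos x)]
  calc |x| * F x ≤ |x| * (1 / (2 * Real.sqrt Real.pi) * (Real.exp 1 * Real.exp x)) := by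
        gcongr
        exact F_le_exp x
    _ = _ := by ring

/-- **Rolle's theorem** on a half-line `(-∞, b)`. -/
lemma exists_hasDerivAt_eq_zero_of_tendsto_atBot {f f' : ℝ → ℝ} {b : ℝ}
    (hf : ∀ x, HasDerivAt f (f' x) x) (hbot : Tendsto f atBot (𝓝 (f b))) :
    ∃ c < b, f' c = 0 := by
  obtain ⟨u, ⟨hu0, hub⟩, hu⟩ := exists_hasDerivAt_eq_zero' (f := fun u => f (Real.log u))
    (f' := fun u => f' (Real.log u) * u⁻¹) (Real.exp_pos b)
    (hbot.comp Real.tendsto_log_nhdsGT_zero)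
    (by
      have hcont : ContinuousAt (fun u => f (Real.log u)) (Real.exp b) :=
        (hf _).continuousAt.comp (Real.continuousAt_log (Real.exp_ne_zero b))
      simpa using hcont.tendsto.mono_left (nhdsWithin_le_nhds (s := Set.Iio (Real.exp b))))
    (fun u hu => (hf _).comp u (Real.hasDerivAt_log hu.1.ne'))
  exact ⟨Real.log u, (Real.log_lt_iff_lt_exp hu0).2 hub,
    (mul_eq_zero.1 hu).resolve_right (inv_ne_zero hu0.ne')⟩

lemma exists_lt_F_mean_value (x : ℝ) :
    ∃ θ < x, (1 / F x) * (x / 2 + F' x / F x) = 1 / (4 * F' θ) := by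
  set N : ℝ → ℝ := fun t => t / 2 * F t + F' t with hN
  have hN' (t : ℝ) : HasDerivAt N (F t / 2) t := by
    refine ((((hasDerivAt_id t).div_const 2).mul (hasDerivAt_F t)).add
      (hasDerivAt_F' t)).congr_deriv ?_
    simp only [id]
    ring
  have hN0 : Tendsto N atBot (𝓝 0) := by
    have h := (tendsto_mul_F_atBot.div_const 2).add tendsto_F'_atBot
    rw [zero_div, zero_add] at h
    exact h.congr fun t => by simp only [hN]; ring
  obtain ⟨θ, hθ, h⟩ := exists_hasDerivAt_eq_zero_of_tendsto_atBot (b := x)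
    (fun t => (((hasDerivAt_F t).pow 2).mul_const (N x)).sub ((hN' t).mul_const (F x ^ 2)))
    (by
      have h := ((tendsto_F_atBot.pow 2).mul_const (N x)).sub (hN0.mul_const (F x ^ 2))
      rw [show 0 ^ 2 * N x - 0 * F x ^ 2 = F x ^ 2 * N x - N x * F x ^ 2 by ring] at h
      exact h)
  refine ⟨θ, hθ, ?_⟩
  have hFθ := (F_pos θ).ne'
  have hFx := (F_pos x).ne'
  have hF'θ := (F'_pos θ).ne'
  have key : 4 * F' θ * N x = F x ^ 2 := by
    apply mul_left_cancel₀ hFθ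
    push_cast at h
    linear_combination 2 * h
  simp only [hN] at key
  field_simp
  linear_combination 2 * key

/-- The `x = +∞` and `y = −∞` limiting cases of the Cauchy mean value identities for `F`:
for every `y` there is `θ > y` with `(1/(1 − F(y)))(−y/2 + F'(y)/(1 − F(y))) = 1/(4F'(θ))`,
and for every `x` there is `θ' < x` with `(1/F(x))(x/2 + F'(x)/F(x)) = 1/(4F'(θ'))`. -/
theorem stmt11 :
    (∀ y : ℝ, ∃ θ : ℝ, y < θ ∧
      (1 / (1 - F y)) * (-y / 2 + F' y / (1 - F y)) = 1 / (4 * F' θ)) ∧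
    (∀ x : ℝ, ∃ θ' : ℝ, θ' < x ∧
      (1 / F x) * (x / 2 + F' x / F x) = 1 / (4 * F' θ')) := by
  refine ⟨fun y => ?_, exists_lt_F_mean_value⟩
  obtain ⟨θ, hθ, h⟩ := exists_lt_F_mean_value (-y)
  refine ⟨-θ, lt_neg.2 hθ, ?_⟩
  rw [F'_neg, ← h, F_neg, F'_neg]
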